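/- arXiv:2211.14932 — 2 statements merged into one kernel-verified Lean document; each statement's English description precedes it below -/
import Mathlib

section
/- Let r : S × A → [0,1] be a bounded reward function, let P_⋆ and P̂ be two dynamics on the same layered state space, and consider the MDPs M = (S, A, P_⋆, r, s_0, H) and M̂ = (S, A, P̂, r, s_0, H). Then for any deterministic policy π : S → A, every layer index h ∈ {0, …, H−1}, and every state s ∈ S_h: V^π_{M̂,h}(s) ≤ (1 + 1/H)^{H−h} · [ V^π_{M,h}(s) + E_{P_⋆,π}[ Σ_{h'=h}^{H−1} 3H² · D_H²(P̂(·|s_{h'},a_{h'}), P_⋆(·|s_{h'},a_{h'})) | s_h = s ] ], where E_{P_⋆,π}[ Σ_{h'=h}^{H−1} g(s_{h'},a_{h'}) | s_h = s ] denotes the sum over layers h' ≥ h of the expectation of g under the occupancy measures of the process that starts at state s in layer h and acts with π under P_⋆. -/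
open scoped BigOperators Classical
open Finset

noncomputable section

/-- Squared Hellinger distance between two distributions on a finite set. -/
def hellingerSq {X : Type*} [Fintype X] (P Q : X → ℝ) : ℝ :=
  ∑ x, (Real.sqrt (P x) - Real.sqrt (Q x)) ^ 2

variable {S : ℕ → Type} [∀ h, Fintype (S h)] {A : Type} [Fintype A]

/-- Value function of a deterministic policy in a layered MDP, defined by the backward
Bellman recursion: `val P r pol k h s` is the value with `k` steps to go, starting at
state `s` in layer `h`.  The layer-`h` value function of the horizon-`H` MDP is
`val P r pol (H - h) h`. -/
def val (P : ∀ h, S h → A → S (h + 1) → ℝ) (r : ∀ h, S h → A → ℝ)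
    (pol : ∀ h, S h → A) : (k : ℕ) → (h : ℕ) → S h → ℝ
  | 0, _, _ => 0
  | k + 1, h, s =>
      r h s (pol h s) + ∑ s' : S (h + 1), P h s (pol h s) s' * val P r pol k (h + 1) s'

/-- State-occupancy measure: `stateOcc P pol h0 st k s` is the probability of being at
state `s` in layer `h0 + k` when acting with the deterministic policy `pol` under
dynamics `P`, starting from state `st` in layer `h0`. -/
def stateOcc (P : ∀ h, S h → A → S (h + 1) → ℝ) (pol : ∀ h, S h → A)
    (h0 : ℕ) (st : S h0) : (k : ℕ) → S (h0 + k) → ℝ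
  | 0, s => if s = st then 1 else 0
  | k + 1, s' =>
      ∑ s : S (h0 + k), stateOcc P pol h0 st k s * P (h0 + k) s (pol (h0 + k) s) s'

/-- State-action occupancy measure started at `st` in layer `h0`. -/
def occ (P : ∀ h, S h → A → S (h + 1) → ℝ) (pol : ∀ h, S h → A)
    (h0 : ℕ) (st : S h0) (k : ℕ) (s : S (h0 + k)) (a : A) : ℝ :=
  if a = pol (h0 + k) s then stateOcc P pol h0 st k s else 0

/-- State-occupancy measure started from the initial state `s0` of layer `0`:
probability of being at state `s` in layer `h`. -/
def stateOcc0 (P : ∀ h, S h → A → S (h + 1) → ℝ) (pol : ∀ h, S h → A)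
    (s0 : S 0) : (h : ℕ) → S h → ℝ
  | 0, s => if s = s0 then 1 else 0
  | h + 1, s' => ∑ s : S h, stateOcc0 P pol s0 h s * P h s (pol h s) s'

/-- State-action occupancy measure `q_h(s, a | pol, P)` started from the initial state. -/
def occ0 (P : ∀ h, S h → A → S (h + 1) → ℝ) (pol : ∀ h, S h → A)
    (s0 : S 0) (h : ℕ) (s : S h) (a : A) : ℝ :=
  if a = pol h s then stateOcc0 P pol s0 h s else 0


/-- The value function is the expected cumulative reward under the occupancy measures, with the
value at an intermediate layer `h + m` accounting for the remaining rewards. -/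
theorem val_eq_sum_stateOcc_add (P : ∀ h, S h → A → S (h + 1) → ℝ) (g : ∀ h, S h → A → ℝ)
    (pol : ∀ h, S h → A) (h : ℕ) (s : S h) (N m : ℕ) (hm : m ≤ N) :
    val P g pol N h s =
      ∑ k ∈ Finset.range m, ∑ s' : S (h + k),
          stateOcc P pol h s k s' * g (h + k) s' (pol (h + k) s') +
        ∑ s' : S (h + m), stateOcc P pol h s m s' * val P g pol (N - m) (h + m) s' := by
  induction m with
  | zero => simp [stateOcc]
  | succ m ih =>
    rw [ih (by omega), Finset.sum_range_succ, add_assoc]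
    congr 1
    obtain ⟨n, rfl⟩ : ∃ n, N = n + (m + 1) := ⟨N - (m + 1), by omega⟩
    rw [show n + (m + 1) - m = n + 1 by omega, Nat.add_sub_cancel]
    simp only [_root_.val, mul_add, Finset.sum_add_distrib]
    congr 1
    change _ = ∑ s' : S (h + m + 1),
      (∑ x : S (h + m), stateOcc P pol h s m x * P (h + m) x (pol (h + m) x) s') *
        val P g pol n (h + m + 1) s'
    simp only [Finset.mul_sum, Finset.sum_mul]
    rw [Finset.sum_comm]
    simp only [mul_assoc]

/-- The expected cumulative reward under the state-action occupancy measures is the value. -/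
theorem sum_occ_mul_eq_val (P : ∀ h, S h → A → S (h + 1) → ℝ) (g : ∀ h, S h → A → ℝ)
    (pol : ∀ h, S h → A) (h : ℕ) (s : S h) (N : ℕ) :
    ∑ k ∈ Finset.range N, ∑ s' : S (h + k), ∑ a : A,
        occ P pol h s k s' a * g (h + k) s' a = val P g pol N h s := by
  rw [val_eq_sum_stateOcc_add P g pol h s N N le_rfl]
  simp [_root_.val, occ]

theorem hellingerSq_nonneg {X : Type*} [Fintype X] (P Q : X → ℝ) : 0 ≤ hellingerSq P Q :=
  Finset.sum_nonneg fun _ _ => sq_nonneg _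

theorem le_one_add_inv_mul_add_sq_sqrt_sub {p q x : ℝ} (hp : 0 ≤ p) (hq : 0 ≤ q) (hx : 0 < x) :
    p ≤ (1 + 1 / x) * q + (1 + x) * (Real.sqrt p - Real.sqrt q) ^ 2 := by
  have h : (1 + 1 / x) * q + (1 + x) * (Real.sqrt p - Real.sqrt q) ^ 2 - p =
      (x * (Real.sqrt p - Real.sqrt q) - Real.sqrt q) ^ 2 / x := by
    obtain ⟨u, hu, rfl⟩ : ∃ u, 0 ≤ u ∧ p = u ^ 2 := ⟨_, Real.sqrt_nonneg p, (Real.sq_sqrt hp).symm⟩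
    obtain ⟨v, hv, rfl⟩ : ∃ v, 0 ≤ v ∧ q = v ^ 2 := ⟨_, Real.sqrt_nonneg q, (Real.sq_sqrt hq).symm⟩
    rw [Real.sqrt_sq hu, Real.sqrt_sq hv]
    field_simp
    ring
  have : 0 ≤ (x * (Real.sqrt p - Real.sqrt q) - Real.sqrt q) ^ 2 / x := by positivity
  linarith

/-- Multiplicative change of measure in squared Hellinger distance for functions bounded
by `B`. -/
theorem sum_mul_le_add_hellingerSq {X : Type*} [Fintype X] {P Q W : X → ℝ} {x B : ℝ}
    (hP : ∀ i, 0 ≤ P i) (hQ : ∀ i, 0 ≤ Q i) (hx : 0 < x)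
    (hW0 : ∀ i, 0 ≤ W i) (hWB : ∀ i, W i ≤ B) :
    ∑ i, P i * W i ≤ (1 + 1 / x) * ∑ i, Q i * W i + (1 + x) * B * hellingerSq P Q := by
  rw [hellingerSq, Finset.mul_sum, Finset.mul_sum, ← Finset.sum_add_distrib]
  refine Finset.sum_le_sum fun i _ => ?_
  have h1 := mul_le_mul_of_nonneg_right
    (le_one_add_inv_mul_add_sq_sqrt_sub (hP i) (hQ i) hx) (hW0 i)
  have h2 : (1 + x) * (Real.sqrt (P i) - Real.sqrt (Q i)) ^ 2 * W i ≤
      (1 + x) * (Real.sqrt (P i) - Real.sqrt (Q i)) ^ 2 * B :=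
    mul_le_mul_of_nonneg_left (hWB i) (by positivity)
  linarith

theorem val_nonneg_and_le {P : ∀ h, S h → A → S (h + 1) → ℝ} {r : ∀ h, S h → A → ℝ} {H : ℕ}
    (hP0 : ∀ h, h < H → ∀ s a s', 0 ≤ P h s a s')
    (hP1 : ∀ h, h < H → ∀ s a, (∑ s', P h s a s') = 1)
    (hr : ∀ h s a, 0 ≤ r h s a ∧ r h s a ≤ 1) (pol : ∀ h, S h → A)
    (k h : ℕ) (hk : h + k ≤ H) (s : S h) :
    0 ≤ val P r pol k h s ∧ val P r pol k h s ≤ k := by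
  induction k generalizing h with
  | zero => simp [_root_.val]
  | succ k ih =>
    have hp := hP0 h (by omega) s (pol h s)
    have hv := ih (h + 1) (by omega)
    have h0 : 0 ≤ ∑ s', P h s (pol h s) s' * val P r pol k (h + 1) s' :=
      Finset.sum_nonneg fun i _ => mul_nonneg (hp i) (hv i).1
    have h1 : ∑ s', P h s (pol h s) s' * val P r pol k (h + 1) s' ≤ k :=
      calc _ ≤ ∑ s', P h s (pol h s) s' * (k : ℝ) :=
            Finset.sum_le_sum fun i _ => mul_le_mul_of_nonneg_left (hv i).2 (hp i)
        _ = k := by rw [← Finset.sum_mul, hP1 h (by omega), one_mul]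
    have := hr h s (pol h s)
    simp only [_root_.val, Nat.cast_add, Nat.cast_one]
    constructor <;> linarith

/-- Value change of measure, with the Hellinger error written as the value of a reward. -/
theorem val_le_pow_mul_val_add_val {H : ℕ} (hH : 1 ≤ H)
    {Pstar Phat : ∀ h, S h → A → S (h + 1) → ℝ}
    (hPstar0 : ∀ h, h < H → ∀ s a s', 0 ≤ Pstar h s a s')
    (hPhat0 : ∀ h, h < H → ∀ s a s', 0 ≤ Phat h s a s')
    (hPhat1 : ∀ h, h < H → ∀ s a, (∑ s', Phat h s a s') = 1)
    {r : ∀ h, S h → A → ℝ} (hr : ∀ h s a, 0 ≤ r h s a ∧ r h s a ≤ 1)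
    (pol : ∀ h, S h → A) (k h : ℕ) (hk : h + k ≤ H) (s : S h) :
    val Phat r pol k h s ≤ (1 + 1 / (H : ℝ)) ^ k *
      (val Pstar r pol k h s +
        val Pstar (fun h s a => 3 * (H : ℝ) ^ 2 * hellingerSq (Phat h s a) (Pstar h s a))
          pol k h s) := by
  induction k generalizing h with
  | zero => simp [_root_.val]
  | succ k ih =>
    set g : ∀ h, S h → A → ℝ :=
      fun h s a => 3 * (H : ℝ) ^ 2 * hellingerSq (Phat h s a) (Pstar h s a) with hg
    have hH' : (1 : ℝ) ≤ H := by exact_mod_cast hH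
    have hbd := val_nonneg_and_le hPhat0 hPhat1 hr pol k (h + 1) (by omega)
    have hkH : (k : ℝ) ≤ H := by exact_mod_cast (by omega : k ≤ H)
    have hcm := sum_mul_le_add_hellingerSq (hPhat0 h (by omega) s (pol h s))
      (hPstar0 h (by omega) s (pol h s)) (by linarith : (0 : ℝ) < H)
      (fun i => (hbd i).1) (fun i => (hbd i).2.trans hkH)
    have hih : ∑ s', Pstar h s (pol h s) s' * val Phat r pol k (h + 1) s' ≤
        (1 + 1 / (H : ℝ)) ^ k *
          (∑ s', Pstar h s (pol h s) s' * val Pstar r pol k (h + 1) s' +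
            ∑ s', Pstar h s (pol h s) s' * val Pstar g pol k (h + 1) s') := by
      rw [← Finset.sum_add_distrib, Finset.mul_sum]
      refine Finset.sum_le_sum fun i _ => ?_
      have := mul_le_mul_of_nonneg_left (ih (h + 1) (by omega) i)
        (hPstar0 h (by omega) s (pol h s) i)
      linarith
    have hc : 1 ≤ 1 + 1 / (H : ℝ) := by
      have : 0 ≤ 1 / (H : ℝ) := by positivity
      linarith
    have hpow : 1 ≤ (1 + 1 / (H : ℝ)) ^ (k + 1) := one_le_pow₀ hc
    have hD := hellingerSq_nonneg (Phat h s (pol h s)) (Pstar h s (pol h s))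
    have herr : (1 + (H : ℝ)) * H * hellingerSq (Phat h s (pol h s)) (Pstar h s (pol h s)) ≤
        g h s (pol h s) :=
      mul_le_mul_of_nonneg_right (by nlinarith) hD
    have hg0 : 0 ≤ g h s (pol h s) := by positivity
    have hloc : r h s (pol h s) + g h s (pol h s) ≤
        (1 + 1 / (H : ℝ)) ^ (k + 1) * (r h s (pol h s) + g h s (pol h s)) :=
      le_mul_of_one_le_left (add_nonneg (hr h s (pol h s)).1 hg0) hpow
    have hstep := mul_le_mul_of_nonneg_left hih (by linarith : 0 ≤ 1 + 1 / (H : ℝ))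
    rw [← mul_assoc, ← pow_succ'] at hstep
    simp only [_root_.val]
    linarith

/-- Backward-induction step of the value change of measure: for every layer `h < H`
and state `s ∈ S_h`,
`V^π_{M̂,h}(s) ≤ (1+1/H)^{H-h} [ V^π_{M,h}(s) + E_{P⋆,π}[ Σ_{h'≥h} 3H² D_H²(...) | s_h = s ] ]`. -/
theorem stmt5
    (H : ℕ) (hH : 1 ≤ H)
    (s0 : S 0) (hS0 : ∀ s : S 0, s = s0)
    (Pstar Phat : ∀ h, S h → A → S (h + 1) → ℝ)
    (hPstar0 : ∀ h, h < H → ∀ s a s', 0 ≤ Pstar h s a s')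
    (hPstar1 : ∀ h, h < H → ∀ s a, (∑ s', Pstar h s a s') = 1)
    (hPhat0 : ∀ h, h < H → ∀ s a s', 0 ≤ Phat h s a s')
    (hPhat1 : ∀ h, h < H → ∀ s a, (∑ s', Phat h s a s') = 1)
    (r : ∀ h, S h → A → ℝ)
    (hr : ∀ h s a, 0 ≤ r h s a ∧ r h s a ≤ 1)
    (pol : ∀ h, S h → A) :
    ∀ h, h < H → ∀ s : S h,
      val Phat r pol (H - h) h s ≤
        (1 + 1 / (H : ℝ)) ^ (H - h) *
          (val Pstar r pol (H - h) h s +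
            ∑ k ∈ Finset.range (H - h), ∑ s' : S (h + k), ∑ a : A,
              occ Pstar pol h s k s' a *
                (3 * (H : ℝ) ^ 2 *
                  hellingerSq (Phat (h + k) s' a) (Pstar (h + k) s' a))) := by
  intro h hh s
  rw [sum_occ_mul_eq_val Pstar
    (fun h s a => 3 * (H : ℝ) ^ 2 * hellingerSq (Phat h s a) (Pstar h s a))]
  exact val_le_pow_mul_val_add_val hH hPstar0 hPhat0 hPhat1 hr pol (H - h) h (by omega) s

end
end

section
/- Fix integers T ≥ 1, t with 1 ≤ t ≤ T, H > 10, integers N_F ≥ 1 and N_P ≥ 1, δ ∈ (0,1), and β_r, β_P > 0. Let f_⋆, f̂_t : C × S × A → [0,1], let P_⋆ and P̂_t be context-dependent dynamics, and let π_1, …, π_{t−1} ∈ Π_C define the bonuses b^R_t, b^P_t. Define the optimistic MDP M̂_t(c) := (S, A, P̂^c_t, r̂^c_t, s_0, H) where r̂^c_t(s,a) := f̂_t(c,s,a) + b^R_t(c,s,a) + b^P_t(c,s,a), and write M(c) := M^{(f_⋆,P_⋆)}(c). Assume the confidence bound: for every π ∈ Π_C, | E_c[ V^{π(c;·)}_{M(c)}(s_0)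 − V^{π(c;·)}_{M^{(f̂_t,P̂_t)}(c)}(s_0) ] | ≤ (112H³/β_r) · log(18T⁴H·N_F·N_P/δ²) + (157H⁴/β_P) · log(3TH·N_P/δ) + E_c[ Σ_{h=0}^{H−1} Σ_{s∈S_h} Σ_{a∈A} q_h(s,a|π(c;·),P̂^c_t) · ( b^R_t(c,s,a) + b^P_t(c,s,a) ) ]. Let π_⋆ ∈ Π_C be an optimal context-dependent policy for M (for each c, π_⋆(c;·) maximizes V^π_{M(c)}(s_0) over deterministic policies π) and let π_t ∈ Π_C satisfy, for each c, π_t(c;·) ∈ argmax_{π : S→A} V^π_{M̂_t(c)}(s_0). Then E_c[ V^{π_⋆(c;·)}_{M(c)}(s_0) ] ≤ E_c[ V^{π_t(c;·)}_{M̂_t(c)}(s_0) ] + (157H⁴/β_P) · log(3TH·N_P/δ) + (112H³/β_r) · log(18T⁴H·N_F·N_P/δ²). -/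
open scoped BigOperators Classical
open Finset

noncomputable section

variable {S : ℕ → Type} [∀ h, Fintype (S h)] {A : Type} [Fintype A]

variable {C : Type} [Fintype C]

/-- Reward bonus `b^R_t(c,s,a)` built from the past policies `pols 0, …, pols (t-2)`
(representing `π_1, …, π_{t-1}`) and the approximated dynamics `Phat`. -/
def bonusR (Phat : C → ∀ h, S h → A → S (h + 1) → ℝ)
    (pols : ℕ → C → ∀ h, S h → A) (s0 : S 0) (t : ℕ) (br : ℝ)
    (c : C) (h : ℕ) (s : S h) (a : A) : ℝ :=
  min 1 ((br / 2) / (1 + ∑ i ∈ Finset.range (t - 1), occ0 (Phat c) (pols i c) s0 h s a))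

/-- Reward bonus `b^P_t(c,s,a)` built from the past policies `pols 0, …, pols (t-2)`
(representing `π_1, …, π_{t-1}`) and the approximated dynamics `Phat`. -/
def bonusP (Phat : C → ∀ h, S h → A → S (h + 1) → ℝ)
    (pols : ℕ → C → ∀ h, S h → A) (s0 : S 0) (t : ℕ) (bp : ℝ) (H : ℕ)
    (c : C) (h : ℕ) (s : S h) (a : A) : ℝ :=
  min (H : ℝ)
    ((bp * H / 2) / (1 + ∑ i ∈ Finset.range (t - 1), occ0 (Phat c) (pols i c) s0 h s a))

/-- The expected `k`-step value at layer `h` under the occupancy measure is the expected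
reward collected in the layers `h, …, h + k - 1`. -/
theorem sum_stateOcc0_mul_val (P : ∀ h, S h → A → S (h + 1) → ℝ) (r : ∀ h, S h → A → ℝ)
    (pol : ∀ h, S h → A) (s0 : S 0) (k h : ℕ) :
    ∑ s, stateOcc0 P pol s0 h s * val P r pol k h s =
      ∑ j ∈ Finset.Ico h (h + k), ∑ s : S j, ∑ a : A, occ0 P pol s0 j s a * r j s a := by
  induction k generalizing h with
  | zero => simp [_root_.val]
  | succ k ih =>
    rw [Finset.sum_eq_sum_Ico_succ_bot (by omega), show h + (k + 1) = h + 1 + k by omega,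
      ← ih (h + 1)]
    simp only [_root_.val, stateOcc0, mul_add, Finset.sum_add_distrib]
    congr 1
    · simp [occ0]
    · simp only [Finset.mul_sum, Finset.sum_mul]
      rw [Finset.sum_comm]
      simp only [mul_assoc]

/-- The value at the initial state is the reward integrated against the occupancy measure. -/
theorem val_eq_sum_occ0 (P : ∀ h, S h → A → S (h + 1) → ℝ) (r : ∀ h, S h → A → ℝ)
    (pol : ∀ h, S h → A) (s0 : S 0) (H : ℕ) :
    val P r pol H 0 s0 =
      ∑ h ∈ Finset.range H, ∑ s : S h, ∑ a : A, occ0 P pol s0 h s a * r h s a := by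
  have key := sum_stateOcc0_mul_val P r pol s0 H 0
  rw [zero_add, ← Finset.range_eq_Ico] at key
  simpa [stateOcc0] using key

/-- The value is additive in the reward, the added part being integrated against the
occupancy measure. -/
theorem val_add_reward (P : ∀ h, S h → A → S (h + 1) → ℝ) (r b : ∀ h, S h → A → ℝ)
    (pol : ∀ h, S h → A) (s0 : S 0) (H : ℕ) :
    val P (fun h s a => r h s a + b h s a) pol H 0 s0 = val P r pol H 0 s0 +
      ∑ h ∈ Finset.range H, ∑ s : S h, ∑ a : A, occ0 P pol s0 h s a * b h s a := by
  simp only [val_eq_sum_occ0, mul_add, Finset.sum_add_distrib]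

/-- Optimism in expectation (`lemma:opt-in-expectation-main`): under the confidence
bound, the expected optimistic value of the played policy upper bounds the expected
optimal value, up to the stated additive error. -/
theorem stmt11
    (H : ℕ) (hH : 10 < H)
    (s0 : S 0) (hS0 : ∀ s : S 0, s = s0)
    (D : C → ℝ) (hD0 : ∀ c, 0 ≤ D c) (hD1 : (∑ c, D c) = 1)
    (T t : ℕ) (hT : 1 ≤ T) (ht : 1 ≤ t) (htT : t ≤ T)
    (NF NP : ℕ) (hNF : 1 ≤ NF) (hNP : 1 ≤ NP)
    (del : ℝ) (hdel0 : 0 < del) (hdel1 : del < 1)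
    (br bp : ℝ) (hbr : 0 < br) (hbp : 0 < bp)
    (fstar fhat : C → ∀ h, S h → A → ℝ)
    (hfstar : ∀ c h s a, 0 ≤ fstar c h s a ∧ fstar c h s a ≤ 1)
    (hfhat : ∀ c h s a, 0 ≤ fhat c h s a ∧ fhat c h s a ≤ 1)
    (Pstar Phat : C → ∀ h, S h → A → S (h + 1) → ℝ)
    (hPstar0 : ∀ c h, h < H → ∀ s a s', 0 ≤ Pstar c h s a s')
    (hPstar1 : ∀ c h, h < H → ∀ s a, (∑ s', Pstar c h s a s') = 1)
    (hPhat0 : ∀ c h, h < H → ∀ s a s', 0 ≤ Phat c h s a s')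
    (hPhat1 : ∀ c h, h < H → ∀ s a, (∑ s', Phat c h s a s') = 1)
    (pols : ℕ → C → ∀ h, S h → A)
    -- the optimistic reward of the approximated optimistic MDP `M̂_t(c)`
    (rhat : C → ∀ h, S h → A → ℝ)
    (hrhat : ∀ c h (s : S h) a,
      rhat c h s a =
        fhat c h s a + bonusR Phat pols s0 t br c h s a +
          bonusP Phat pols s0 t bp H c h s a)
    -- confidence bound (the good event of `corl:UCB-value-main`)
    (hCB : ∀ pol : C → ∀ h, S h → A,
      |∑ c, D c * (val (Pstar c) (fstar c) (pol c) H 0 s0 -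
          val (Phat c) (fhat c) (pol c) H 0 s0)| ≤
        (112 * (H : ℝ) ^ 3 / br) *
            Real.log (18 * (T : ℝ) ^ 4 * H * NF * NP / del ^ 2) +
          (157 * (H : ℝ) ^ 4 / bp) * Real.log (3 * (T : ℝ) * H * NP / del) +
          (∑ c, D c * ∑ h ∈ Finset.range H, ∑ s : S h, ∑ a : A,
            occ0 (Phat c) (pol c) s0 h s a *
              (bonusR Phat pols s0 t br c h s a +
                bonusP Phat pols s0 t bp H c h s a)))
    -- `polstar` is an optimal context-dependent policy for the true CMDP
    (polstar : C → ∀ h, S h → A)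
    (hpolstar : ∀ c, ∀ p : ∀ h, S h → A,
      val (Pstar c) (fstar c) p H 0 s0 ≤ val (Pstar c) (fstar c) (polstar c) H 0 s0)
    -- `polt` is an optimal context-dependent policy for the optimistic CMDP `M̂_t`
    (polt : C → ∀ h, S h → A)
    (hpolt : ∀ c, ∀ p : ∀ h, S h → A,
      val (Phat c) (rhat c) p H 0 s0 ≤ val (Phat c) (rhat c) (polt c) H 0 s0) :
    (∑ c, D c * val (Pstar c) (fstar c) (polstar c) H 0 s0) ≤
      (∑ c, D c * val (Phat c) (rhat c) (polt c) H 0 s0) +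
        (157 * (H : ℝ) ^ 4 / bp) * Real.log (3 * (T : ℝ) * H * NP / del) +
        (112 * (H : ℝ) ^ 3 / br) *
          Real.log (18 * (T : ℝ) ^ 4 * H * NF * NP / del ^ 2) := by
  have hval (c : C) : val (Phat c) (rhat c) (polstar c) H 0 s0 =
      val (Phat c) (fhat c) (polstar c) H 0 s0 +
        ∑ h ∈ Finset.range H, ∑ s : S h, ∑ a : A,
          occ0 (Phat c) (polstar c) s0 h s a *
            (bonusR Phat pols s0 t br c h s a + bonusP Phat pols s0 t bp H c h s a) := by
    rw [← val_add_reward]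
    congr 1
    funext h s a
    rw [hrhat, add_assoc]
  have hopt : ∑ c, D c * val (Phat c) (rhat c) (polstar c) H 0 s0 ≤
      ∑ c, D c * val (Phat c) (rhat c) (polt c) H 0 s0 :=
    Finset.sum_le_sum fun c _ => mul_le_mul_of_nonneg_left (hpolt c (polstar c)) (hD0 c)
  have hconf := (le_abs_self _).trans (hCB polstar)
  simp only [hval, mul_add, Finset.sum_add_distrib] at hopt
  simp only [mul_sub, mul_add, Finset.sum_add_distrib, Finset.sum_sub_distrib] at hconf
  linarith

end
end
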